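/- For all n ≥ 1, the following polynomial identity holds in ℤ[q]: the sum over all 321-avoiding permutations π of {1,…,2n} of sign(π)·q^{ldes(π)} equals (1−q) times the sum over all 321-avoiding permutations π of {1,…,n} of q^{2·ldes(π)}. -/

import Mathlib

open scoped Classical
open Polynomial

/-- A permutation of `{1,…,n}` (modeled on `Fin n`) is 321-avoiding if there are no
indices `i < j < k` with `π i > π j > π k`. -/
def Avoids321 {n : ℕ} (π : Equiv.Perm (Fin n)) : Prop :=
  ¬ ∃ i j k : Fin n, i < j ∧ j < k ∧ π k < π j ∧ π j < π i

/-- The length of the longest increasing subsequence of a permutation. -/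
noncomputable def lis {n : ℕ} (π : Equiv.Perm (Fin n)) : ℕ :=
  sSup {k : ℕ | ∃ s : Finset (Fin n),
    (∀ i ∈ s, ∀ j ∈ s, i < j → π i < π j) ∧ s.card = k}

/-- The last (largest) descent of a permutation, in 1-based positions:
the largest `d` with `π(d) > π(d+1)`, and `0` for the identity (no descent). -/
noncomputable def ldes {n : ℕ} (π : Equiv.Perm (Fin n)) : ℕ :=
  sSup {d : ℕ | 1 ≤ d ∧ ∃ h : d < n, π ⟨d, h⟩ < π ⟨d - 1, by omega⟩}

/-- Insert the value `n` at position `p` into a permutation of `Fin n`. -/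
def insertMax {n : ℕ} (p : Fin (n + 1)) (σ : Equiv.Perm (Fin n)) : Equiv.Perm (Fin (n + 1)) :=
  (finSuccEquiv' p).trans ((Equiv.optionCongr σ).trans (finSuccEquiv' (Fin.last n)).symm)

@[simp]
lemma insertMax_self {n : ℕ} (p : Fin (n + 1)) (σ : Equiv.Perm (Fin n)) :
    insertMax p σ p = Fin.last n := by
  simp [insertMax]

@[simp]
lemma insertMax_succAbove {n : ℕ} (p : Fin (n + 1)) (σ : Equiv.Perm (Fin n)) (i : Fin n) :
    insertMax p σ (p.succAbove i) = (σ i).castSucc := by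
  simp [insertMax]

lemma insertMax_bijective (n : ℕ) :
    Function.Bijective (fun x : Fin (n + 1) × Equiv.Perm (Fin n) => insertMax x.1 x.2) := by
  rw [Fintype.bijective_iff_injective_and_card]
  constructor
  · rintro ⟨p, σ⟩ ⟨q, τ⟩ h
    have h : insertMax p σ = insertMax q τ := h
    have hpq : p = q := by
      apply (insertMax q τ).injective
      rw [← h, insertMax_self, h, insertMax_self]
    subst hpq
    congr 1
    ext i : 1
    apply Fin.castSucc_injective
    rw [← insertMax_succAbove p, h, insertMax_succAbove]
  · simp [Fintype.card_perm, Nat.factorial_succ]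

lemma sign_insertMax_last {n : ℕ} (σ : Equiv.Perm (Fin n)) :
    Equiv.Perm.sign (insertMax (Fin.last n) σ) = Equiv.Perm.sign σ := by
  have h := Equiv.Perm.sign_symm_trans_trans (Equiv.optionCongr σ) (finSuccEquiv' (Fin.last n)).symm
  rw [Equiv.optionCongr_sign] at h
  exact h

lemma insertMax_castSucc {n : ℕ} (p : Fin n) (σ : Equiv.Perm (Fin n)) :
    insertMax p.castSucc σ = insertMax p.succ σ * Equiv.swap p.castSucc p.succ := by
  ext x : 1
  rw [Equiv.Perm.mul_apply]
  rcases Fin.eq_self_or_eq_succAbove p.castSucc x with rfl | ⟨i, rfl⟩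
  · simp
  rw [insertMax_succAbove]
  by_cases hi : i = p
  · subst hi
    rw [Fin.succAbove_castSucc_self, Equiv.swap_apply_right]
    conv_rhs => rw [← Fin.succAbove_succ_self i]
    rw [insertMax_succAbove]
  · have h : p.castSucc.succAbove i = p.succ.succAbove i := by
      rcases lt_or_gt_of_ne hi with h | h
      · rw [Fin.succAbove_castSucc_of_lt _ _ h, Fin.succAbove_succ_of_le _ _ h.le]
      · rw [Fin.succAbove_castSucc_of_le _ _ h.le, Fin.succAbove_succ_of_lt _ _ h]
    rw [Equiv.swap_apply_of_ne_of_ne (Fin.succAbove_ne _ _) (h ▸ Fin.succAbove_ne _ _), h,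
      insertMax_succAbove]

lemma sign_insertMax {n : ℕ} (p : Fin (n + 1)) (σ : Equiv.Perm (Fin n)) :
    Equiv.Perm.sign (insertMax p σ) = (-1) ^ (n + p : ℕ) * Equiv.Perm.sign σ := by
  induction p using Fin.reverseInduction with
  | last => simp [sign_insertMax_last, ← two_mul]
  | cast p ih =>
    rw [insertMax_castSucc, Equiv.Perm.sign_mul, ih,
      Equiv.Perm.sign_swap (Fin.castSucc_lt_succ).ne]
    simp [← add_assoc, pow_succ]

lemma ldes_le_iff {n : ℕ} (π : Equiv.Perm (Fin n)) (m : ℕ) :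
    ldes π ≤ m ↔ ∀ i j : Fin n, m ≤ i → i < j → π i < π j := by
  have hbdd : BddAbove {d : ℕ | 1 ≤ d ∧ ∃ h : d < n, π ⟨d, h⟩ < π ⟨d - 1, by omega⟩} :=
    ⟨n, fun d hd => hd.2.1.le⟩
  constructor
  · intro h i j hi hij
    have step : ∀ k (hk : k + 1 < n), m ≤ k → π ⟨k, by omega⟩ < π ⟨k + 1, hk⟩ := by
      intro k hk hmk
      by_contra hlt
      have hne : π ⟨k + 1, hk⟩ ≠ π ⟨k, by omega⟩ := fun h => by simpa using π.injective h
      have := le_csSup hbdd (a := k + 1)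
        ⟨by omega, hk, lt_of_le_of_ne (not_lt.mp hlt) hne⟩
      have : k + 1 ≤ ldes π := this
      omega
    obtain ⟨i, hi'⟩ := i
    obtain ⟨j, hj'⟩ := j
    have hij : i + 1 ≤ j := hij
    induction j, hij using Nat.le_induction with
    | base => exact step i hj' hi
    | succ k hk ih =>
      exact (ih (by omega) (show i < k by omega) step).trans (step k hj' (by simp at hi; omega))
  · intro h
    apply csSup_le'
    rintro d ⟨h1, hd, hlt⟩
    by_contra hmd
    exact lt_asymm hlt (h ⟨d - 1, by omega⟩ ⟨d, hd⟩ (by simp; omega) (by simp [Fin.lt_def]; omega))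

lemma ldes_lt {n : ℕ} (hn : 1 ≤ n) (π : Equiv.Perm (Fin n)) : ldes π < n := by
  have : ldes π ≤ n - 1 := by
    rw [ldes_le_iff]
    intro i j hi hij
    omega
  omega

lemma avoids321_insertMax {n : ℕ} (p : Fin (n + 1)) (σ : Equiv.Perm (Fin n)) :
    Avoids321 (insertMax p σ) ↔ Avoids321 σ ∧ ldes σ ≤ p := by
  rw [ldes_le_iff]
  constructor
  · intro h
    constructor
    · rintro ⟨i, j, k, hij, hjk, h1, h2⟩
      exact h ⟨p.succAbove i, p.succAbove j, p.succAbove k, by simpa, by simpa, by simpa, by simpa⟩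
    · intro i j hi hij
      by_contra hlt
      have hne : σ j ≠ σ i := fun h => hij.ne' (σ.injective h)
      refine h ⟨p, p.succAbove i, p.succAbove j, ?_, by simpa, ?_, ?_⟩
      · rw [Fin.lt_succAbove_iff_le_castSucc]
        exact hi
      · simpa using lt_of_le_of_ne (not_lt.mp hlt) hne
      · simp [Fin.castSucc_lt_last]
  · rintro ⟨h, hinc⟩ ⟨i, j, k, hij, hjk, h1, h2⟩
    rcases Fin.eq_self_or_eq_succAbove p j with rfl | ⟨j, rfl⟩
    · simp at h2
      exact absurd (Fin.le_last _) (not_le.mpr h2)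
    rcases Fin.eq_self_or_eq_succAbove p k with rfl | ⟨k, rfl⟩
    · simp at h1
      exact absurd (Fin.le_last _) (not_le.mpr h1)
    rcases Fin.eq_self_or_eq_succAbove p i with rfl | ⟨i, rfl⟩
    · rw [Fin.lt_succAbove_iff_le_castSucc] at hij
      simp at hjk h1
      exact lt_asymm h1 (hinc j k hij hjk)
    · simp at hij hjk h1 h2
      exact h ⟨i, j, k, hij, hjk, h1, h2⟩

lemma ldes_insertMax_last {n : ℕ} (σ : Equiv.Perm (Fin n)) :
    ldes (insertMax (Fin.last n) σ) = ldes σ := by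
  have hc : ∀ i : Fin n, insertMax (Fin.last n) σ i.castSucc = (σ i).castSucc := fun i => by
    rw [← Fin.succAbove_last_apply, insertMax_succAbove]
  refine eq_of_forall_ge_iff fun m => ?_
  rw [ldes_le_iff, ldes_le_iff]
  constructor
  · intro h i j hi hij
    simpa [hc] using h i.castSucc j.castSucc hi (by simpa)
  · intro h i j hi hij
    induction i using Fin.lastCases with
    | last => exact absurd (Fin.le_last j) (not_le.mpr hij)
    | cast i =>
      induction j using Fin.lastCases with
      | last => simp [hc, Fin.castSucc_lt_last]
      | cast j => simpa [hc] using h i j hi (by simpa using hij)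

lemma ldes_insertMax_castSucc {n : ℕ} (p : Fin n) (σ : Equiv.Perm (Fin n)) (h : ldes σ ≤ p) :
    ldes (insertMax p.castSucc σ) = p + 1 := by
  apply le_antisymm
  · rw [ldes_le_iff] at h ⊢
    intro i j hi hij
    rcases Fin.eq_self_or_eq_succAbove p.castSucc i with rfl | ⟨i, rfl⟩
    · simp at hi
    rcases Fin.eq_self_or_eq_succAbove p.castSucc j with rfl | ⟨j, rfl⟩
    · simp [Fin.castSucc_lt_last]
    · simp only [insertMax_succAbove, Fin.castSucc_lt_castSucc_iff]
      simp at hij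
      refine h i j ?_ hij
      have : p.castSucc < p.castSucc.succAbove i := by
        rw [Fin.lt_def]; simp; omega
      rw [Fin.lt_succAbove_iff_le_castSucc] at this
      exact this
  · by_contra hlt
    have := (ldes_le_iff _ p).mp (by omega : ldes (insertMax p.castSucc σ) ≤ p)
      p.castSucc p.succ le_rfl Fin.castSucc_lt_succ
    rw [insertMax_self] at this
    exact absurd (Fin.le_last _) (not_le.mpr this)

lemma sum_avoids321_succ {M : Type*} [AddCommMonoid M] {n : ℕ} (w : ℕ → ℤ → M) :
    ∑ π ∈ Finset.univ.filter (fun π : Equiv.Perm (Fin (n + 1)) => Avoids321 π),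
        w (ldes π) (Equiv.Perm.sign π : ℤ) =
      ∑ σ ∈ Finset.univ.filter (fun σ : Equiv.Perm (Fin n) => Avoids321 σ),
        (w (ldes σ) (Equiv.Perm.sign σ : ℤ) +
          ∑ p ∈ Finset.Ico (ldes σ) n,
            w (p + 1) ((-1) ^ (n + p) * (Equiv.Perm.sign σ : ℤ))) := by
  rw [Finset.sum_filter, ← (insertMax_bijective n).sum_comp, Fintype.sum_prod_type_right,
    Finset.sum_filter]
  refine Finset.sum_congr rfl fun σ _ => ?_
  simp only [avoids321_insertMax]
  split_ifs with hσ
  · have hle : ldes σ ≤ n := by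
      rw [ldes_le_iff]
      intro i j hi
      omega
    simp only [hσ, true_and]
    rw [Fin.sum_univ_castSucc, add_comm]
    congr 1
    · simp [hle, ldes_insertMax_last, sign_insertMax_last]
    · have : Finset.Ico (ldes σ) n = (Finset.range n).filter (ldes σ ≤ ·) := by
        ext p; simp [and_comm]
      rw [this, Finset.sum_filter, Finset.sum_range]
      refine Finset.sum_congr rfl fun p _ => ?_
      simp only [Fin.val_castSucc]
      split_ifs with hp
      · rw [ldes_insertMax_castSucc p σ hp, sign_insertMax]
        simp
      · rfl
  · simp [hσ]

/-- The linear operator taking the signed `ldes` distribution on 321-avoiding permutations of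
`n` letters to the one on `n + 1` letters. -/
noncomputable def signedStep (n : ℕ) : ℤ[X] →ₗ[ℤ] ℤ[X] :=
  (Polynomial.basisMonomials ℤ).constr ℤ
    (fun l => X ^ l + ∑ p ∈ Finset.Ico l n, (-1) ^ (n + p) * X ^ (p + 1))

lemma signedStep_X_pow (n l : ℕ) :
    signedStep n (X ^ l) = X ^ l + ∑ p ∈ Finset.Ico l n, (-1) ^ (n + p) * X ^ (p + 1) := by
  have h := (Polynomial.basisMonomials ℤ).constr_basis ℤ
    (fun l => (X ^ l + ∑ p ∈ Finset.Ico l n, (-1) ^ (n + p) * X ^ (p + 1) : ℤ[X])) l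
  simp only [Polynomial.coe_basisMonomials, Polynomial.monomial_one_right_eq_X_pow] at h
  exact h

/-- The signed generating polynomial of `ldes` over 321-avoiding permutations. -/
noncomputable def signedLdesPoly (n : ℕ) : ℤ[X] :=
  ∑ π ∈ Finset.univ.filter (fun π : Equiv.Perm (Fin n) => Avoids321 π),
    C ((Equiv.Perm.sign π : ℤ)) * X ^ ldes π

lemma signedLdesPoly_succ (n : ℕ) :
    signedLdesPoly (n + 1) = signedStep n (signedLdesPoly n) := by
  rw [signedLdesPoly, sum_avoids321_succ (fun l s => (C s * X ^ l : ℤ[X])), signedLdesPoly, map_sum]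
  refine Finset.sum_congr rfl fun σ _ => ?_
  rw [← Polynomial.smul_eq_C_mul, map_smul, signedStep_X_pow, smul_add,
    Finset.smul_sum]
  congr 1
  refine Finset.sum_congr rfl fun p _ => ?_
  rw [Polynomial.smul_eq_C_mul, map_mul, map_pow, map_neg, map_one]
  ring

lemma signedStep_even (n l : ℕ) (h : l < n) :
    signedStep (2 * n) ((1 - X) * X ^ (2 * l)) = X ^ (2 * l) := by
  have e : ((1 - X) * X ^ (2 * l) : ℤ[X]) = X ^ (2 * l) - X ^ (2 * l + 1) := by ring
  rw [e, map_sub, signedStep_X_pow, signedStep_X_pow,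
    Finset.sum_eq_sum_Ico_succ_bot (by omega : 2 * l < 2 * n)]
  rw [Even.neg_one_pow ⟨n + l, by ring⟩]
  ring

lemma signedStep_odd (n l : ℕ) (h : l ≤ n) :
    signedStep (2 * n + 1) (X ^ (2 * l)) =
      (1 - X) * (X ^ (2 * l) + ∑ p ∈ Finset.Ico l n, X ^ (2 * (p + 1))) := by
  have sgn : ∀ p, ((-1) ^ (2 * n + 1 + p) : ℤ[X]) = -(-1) ^ p := fun p => by
    rw [pow_add, pow_succ, pow_mul]
    simp
  rw [signedStep_X_pow]
  simp only [sgn]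
  clear sgn
  induction n, h using Nat.le_induction with
  | base =>
    simp
    ring
  | succ n hn ih =>
    rw [show 2 * (n + 1) + 1 = 2 * n + 1 + 1 + 1 by ring, Finset.sum_Ico_succ_top (by omega),
      Finset.sum_Ico_succ_top (by omega), ← add_assoc, ← add_assoc, ih,
      Finset.sum_Ico_succ_top hn]
    have h1 : ((-1) ^ (2 * n + 1) : ℤ[X]) = -1 := Odd.neg_one_pow ⟨n, rfl⟩
    have h2 : ((-1) ^ (2 * n + 1 + 1) : ℤ[X]) = 1 := Even.neg_one_pow ⟨n + 1, by ring⟩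
    rw [h1, h2]
    ring

theorem sign_balance_ldes_even (n : ℕ) (hn : 1 ≤ n) :
    ∑ π ∈ Finset.univ.filter (fun π : Equiv.Perm (Fin (2 * n)) => Avoids321 π),
        C ((Equiv.Perm.sign π : ℤ)) * X ^ ldes π
      =
    (1 - (X : Polynomial ℤ)) *
      ∑ π ∈ Finset.univ.filter (fun π : Equiv.Perm (Fin n) => Avoids321 π),
        (X : Polynomial ℤ) ^ (2 * ldes π) := by
  change signedLdesPoly (2 * n) = _
  induction n, hn using Nat.le_induction with
  | base =>
    have hldes : ∀ π : Equiv.Perm (Fin 1), ldes π = 0 := fun π => by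
      have := ldes_lt le_rfl π
      omega
    have hav : ∀ π : Equiv.Perm (Fin 1), Avoids321 π := by
      rintro π ⟨i, j, k, hij, -⟩
      omega
    have h1 : signedLdesPoly 1 = 1 := by
      simp [signedLdesPoly, hldes, hav]
    rw [mul_one, signedLdesPoly_succ, h1, ← pow_zero X, signedStep_X_pow]
    simp [hldes, hav]
    ring
  | succ n hn ih =>
    rw [show 2 * (n + 1) = 2 * n + 1 + 1 by ring, signedLdesPoly_succ, signedLdesPoly_succ, ih,
      sum_avoids321_succ (fun l _ => (X ^ (2 * l) : ℤ[X])), Finset.mul_sum, Finset.mul_sum,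
      map_sum, map_sum]
    refine Finset.sum_congr rfl fun σ _ => ?_
    have hl := ldes_lt hn σ
    rw [signedStep_even n _ hl, signedStep_odd n _ hl.le]
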